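/- There is no distributional solution ŵ of −Δŵ = μ e^{ŵ} + β δ_0 in ℝ² with μ > 0, β ≥ 8π and ∫_{ℝ²} μ e^{ŵ} dx < ∞. Indeed, any such ŵ would satisfy ŵ(x) ≥ (β/2π) log(1/|x|) − C on B_1(0)∖{0} for some constant C > 0 by Green's representation formula on the unit ball, whence e^{ŵ(x)} ≥ e^{−C}|x|^{−β/2π} would fail to be integrable near the origin. -/

import Mathlib

open Filter Topology Real MeasureTheory

noncomputable section

/-- The Euclidean plane `ℝ²`. -/
abbrev E2 : Type := EuclideanSpace ℝ (Fin 2)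

/-- The Laplacian on `ℝ²` (sum of the second derivatives in the coordinate directions). -/
def lap2 (f : E2 → ℝ) (x : E2) : ℝ :=
  ∑ i : Fin 2,
    iteratedFDeriv ℝ 2 f x ![EuclideanSpace.single i 1, EuclideanSpace.single i 1]

/-- The `C^α` (Hölder) norm of `f` on a set `K ⊆ ℝ²`:
`sup_K |f| + sup_{x ≠ y ∈ K} |f x - f y| / |x - y|^α`. -/
def holderNorm (a : ℝ) (K : Set E2) (f : E2 → ℝ) : ℝ :=
  sSup ((fun x => |f x|) '' K) +
    sSup ((fun p : E2 × E2 => |f p.1 - f p.2| / dist p.1 p.2 ^ a) ''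
      {p : E2 × E2 | p.1 ∈ K ∧ p.2 ∈ K ∧ p.1 ≠ p.2})

/-- `φ` is an admissible (smooth, compactly supported) test function on `ℝ²`. -/
def IsTestFun (φ : E2 → ℝ) : Prop := ContDiff ℝ (⊤ : ℕ∞) φ ∧ HasCompactSupport φ

end


namespace BB

/-- smooth monotone cutoff, `0` for `t ≤ 1`, `1` for `t ≥ 2`. -/
noncomputable def h (t : ℝ) : ℝ := Real.smoothTransition (t - 1)

lemma h_contDiff : ContDiff ℝ (⊤ : ℕ∞) h :=
  Real.smoothTransition.contDiff.comp (contDiff_id.sub contDiff_const)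

lemma h_mono : Monotone h := fun a b hab => Real.smoothTransition.monotone (by linarith)

lemma h_zero {t : ℝ} (ht : t ≤ 1) : h t = 0 :=
  Real.smoothTransition.zero_of_nonpos (by linarith)

lemma h_one {t : ℝ} (ht : 2 ≤ t) : h t = 1 :=
  Real.smoothTransition.one_of_one_le (by linarith)

lemma h_le {t : ℝ} : h t ≤ 1 := Real.smoothTransition.le_one _

lemma h_hasDeriv (t : ℝ) : HasDerivAt h (deriv h t) t :=
  ((h_contDiff.differentiable (by simp)) t).hasDerivAt

lemma dh_nonneg (t : ℝ) : 0 ≤ deriv h t := h_mono.deriv_nonneg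

lemma dh_cont : Continuous (deriv h) := h_contDiff.continuous_deriv (by simp)

lemma dh_zero {t : ℝ} (ht : 2 < t) : deriv h t = 0 := by
  have : h =ᶠ[𝓝 t] fun _ => (1 : ℝ) := by
    filter_upwards [lt_mem_nhds ht] with s hs using h_one hs.le
  rw [this.deriv_eq]; simp

lemma dh_zero' {t : ℝ} (ht : t < 1) : deriv h t = 0 := by
  have : h =ᶠ[𝓝 t] fun _ => (0 : ℝ) := by
    filter_upwards [gt_mem_nhds ht] with s hs using h_zero hs.le
  rw [this.deriv_eq]; simp

lemma dh_bdd : ∃ M, ∀ t, deriv h t ≤ M := by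
  obtain ⟨M, hM⟩ := (isCompact_Icc (a := (1 : ℝ)) (b := 2)).bddAbove_image dh_cont.continuousOn
  refine ⟨max M 0, fun t => ?_⟩
  rcases lt_or_ge t 1 with h1 | h1
  · rw [dh_zero' h1]; exact le_max_right _ _
  rcases lt_or_ge 2 t with h2 | h2
  · rw [dh_zero h2]; exact le_max_right _ _
  exact le_trans (hM ⟨t, ⟨h1, h2⟩, rfl⟩) (le_max_left _ _)

/-- derivative of the radial profile -/
noncomputable def F1 (t : ℝ) : ℝ := -(h t / (2 * t))

lemma F1_contDiff : ContDiff ℝ (⊤ : ℕ∞) F1 := by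
  rw [contDiff_iff_contDiffAt]
  intro t
  rcases lt_or_ge t 1 with h1 | h1
  · have : F1 =ᶠ[𝓝 t] fun _ => (0 : ℝ) := by
      filter_upwards [gt_mem_nhds h1] with s hs
      simp [F1, h_zero (le_of_lt hs)]
    exact contDiffAt_const.congr_of_eventuallyEq this
  · exact (h_contDiff.contDiffAt.div (contDiffAt_const.mul contDiffAt_id)
      (by simp only [id]; positivity)).neg

noncomputable def F (s : ℝ) : ℝ := ∫ t in (0 : ℝ)..s, F1 t

lemma F_hasDeriv (s : ℝ) : HasDerivAt F (F1 s) s :=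
  F1_contDiff.continuous.integral_hasStrictDerivAt 0 s |>.hasDerivAt

lemma F_contDiff : ContDiff ℝ (⊤ : ℕ∞) F := by
  rw [contDiff_infty_iff_deriv]
  refine ⟨fun s => (F_hasDeriv s).differentiableAt, ?_⟩
  rw [show deriv F = F1 from funext fun s => (F_hasDeriv s).deriv]
  exact F1_contDiff

lemma F1_hasDeriv (s : ℝ) : HasDerivAt F1 (deriv F1 s) s :=
  ((F1_contDiff.differentiable (by simp)) s).hasDerivAt

lemma mul_F1 (s : ℝ) : s * F1 s = -(h s) / 2 := by
  rcases eq_or_ne s 0 with rfl | hs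
  · simp [h_zero]
  · unfold F1; field_simp

lemma F1_eq (s : ℝ) : F1 s + s * deriv F1 s = -(deriv h s) / 2 := by
  have h1 := (hasDerivAt_id s).mul (F1_hasDeriv s)
  have h2 := ((h_hasDeriv s).neg).div_const 2
  have : (id * F1) = fun x => (-h) x / 2 := by
    funext x; simpa using mul_F1 x
  rw [this] at h1
  have := h1.unique h2
  simpa using this

noncomputable def G (a s : ℝ) : ℝ := F (a * s) - F s + Real.log a / 2

lemma G_contDiff (a : ℝ) : ContDiff ℝ (⊤ : ℕ∞) (G a) :=
  ((F_contDiff.comp (contDiff_const.mul contDiff_id)).sub F_contDiff).add contDiff_const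

lemma G_zero (a : ℝ) : G a 0 = Real.log a / 2 := by simp [G]

lemma gl_hasDeriv {s : ℝ} (hs : 0 < s) :
    HasDerivAt (fun s => F s + Real.log s / 2) ((1 - h s) / (2 * s)) s := by
  refine ((F_hasDeriv s).add ((Real.hasDerivAt_log hs.ne').div_const 2)).congr_deriv ?_
  unfold F1; field_simp; ring

lemma G_eq {a s : ℝ} (ha : 1 ≤ a) (hs : 0 < s) :
    G a s = (F (a * s) + Real.log (a * s) / 2) - (F s + Real.log s / 2) := by
  unfold G
  rw [Real.log_mul (by positivity) hs.ne']; ring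

lemma G_nonneg {a s : ℝ} (ha : 1 ≤ a) (hs : 0 ≤ s) : 0 ≤ G a s := by
  rcases hs.eq_or_lt with rfl | hs
  · rw [G_zero]; have := Real.log_nonneg ha; positivity
  rw [G_eq ha hs, sub_nonneg]
  have hm : MonotoneOn (fun s => F s + Real.log s / 2) (Set.Ioi 0) := by
    refine monotoneOn_of_deriv_nonneg (convex_Ioi 0)
      (fun x hx => (gl_hasDeriv hx).continuousAt.continuousWithinAt)
      (fun x hx => ?_) (fun x hx => ?_)
    · rw [interior_Ioi] at hx
      exact (gl_hasDeriv hx).differentiableAt.differentiableWithinAt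
    · rw [interior_Ioi] at hx
      have hx' : 0 < x := hx
      rw [(gl_hasDeriv hx).deriv]
      have := h_le (t := x)
      apply div_nonneg <;> linarith
  exact hm hs (show 0 < a * s by positivity) (by nlinarith)

lemma G_far {a s : ℝ} (ha : 1 ≤ a) (hs : 2 < s) : G a s = 0 := by
  have hs0 : 0 < s := by linarith
  rw [G_eq ha hs0, sub_eq_zero]
  refine (convex_Ioi (2 : ℝ)).is_const_of_fderivWithin_eq_zero (𝕜 := ℝ)
    (f := fun s => F s + Real.log s / 2) ?_ ?_ (show 2 < a * s by nlinarith) hs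
  · intro x hx
    have hx' : 2 < x := hx
    exact (gl_hasDeriv (by linarith)).differentiableAt.differentiableWithinAt
  · intro x hx
    have hx' : 2 < x := hx
    rw [fderivWithin_of_isOpen isOpen_Ioi hx]
    have := gl_hasDeriv (s := x) (by linarith)
    rw [h_one hx'.le] at this
    simp only [sub_self, zero_div] at this
    rw [this.hasFDerivAt.fderiv]; simp

lemma lap_radial (g g1 g2 : ℝ → ℝ) (h1 : ∀ s, HasDerivAt g (g1 s) s)
    (h2 : ∀ s, HasDerivAt g1 (g2 s) s) (x : E2) :
    lap2 (fun x => g (‖x‖ ^ 2)) x = 4 * (g1 (‖x‖ ^ 2) + ‖x‖ ^ 2 * g2 (‖x‖ ^ 2)) := by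
  have d1 : fderiv ℝ (fun x : E2 => g (‖x‖ ^ 2)) =
      fun y => (2 * g1 (‖y‖ ^ 2)) • innerSL ℝ y := by
    funext y
    have := (h1 (‖y‖ ^ 2)).comp_hasFDerivAt y (hasStrictFDerivAt_norm_sq y).hasFDerivAt
    have := this.fderiv
    simp only [Function.comp_def] at this
    rw [this]
    ext v; simp; ring
  have d2 : HasFDerivAt (fun y : E2 => (2 * g1 (‖y‖ ^ 2)) • innerSL ℝ y) _ x :=
    (((h2 (‖x‖ ^ 2)).comp_hasFDerivAt x (hasStrictFDerivAt_norm_sq x).hasFDerivAt).const_mul 2).smul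
      (innerSL ℝ (E := E2)).hasFDerivAt
  unfold lap2
  simp only [iteratedFDeriv_two_apply, d1, d2.fderiv]
  simp [EuclideanSpace.norm_sq_eq, Fin.sum_univ_two, EuclideanSpace.inner_single_right]
  have hs : ∀ i : Fin 2, (innerSL ℝ (EuclideanSpace.single i (1 : ℝ) : E2))
      (EuclideanSpace.single i (1 : ℝ)) = 1 := fun i => by
    rw [innerSL_apply_apply]; simp
  have hs0 := hs 0
  have hs1 := hs 1
  linear_combination (2 * g1 (x 0 ^ 2 + x 1 ^ 2)) * hs0 + (2 * g1 (x 0 ^ 2 + x 1 ^ 2)) * hs1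

noncomputable def P (a : ℝ) (x : E2) : ℝ := 2 * a * deriv h (a * ‖x‖ ^ 2)

lemma lap_G (a : ℝ) (x : E2) : -lap2 (fun x => G a (‖x‖ ^ 2)) x = P a x - P 1 x := by
  rw [lap_radial (G a) (fun s => a * F1 (a * s) - F1 s)
    (fun s => a * (a * deriv F1 (a * s)) - deriv F1 s)]
  · have e1 := F1_eq (a * ‖x‖ ^ 2)
    have e2 := F1_eq (‖x‖ ^ 2)
    unfold P
    rw [one_mul]
    linear_combination (-4 * a) * e1 + 4 * e2
  · intro s
    have := (F_hasDeriv (a * s)).comp s ((hasDerivAt_id s).const_mul a)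
    refine ((this.sub (F_hasDeriv s)).add_const _).congr_deriv ?_
    simp; ring
  · intro s
    have := ((F1_hasDeriv (a * s)).comp s ((hasDerivAt_id s).const_mul a)).const_mul a
    refine (this.sub (F1_hasDeriv s)).congr_deriv ?_
    ring

lemma compact_of_far (f : E2 → ℝ) (hf : ∀ x : E2, 2 < ‖x‖ ^ 2 → f x = 0) :
    HasCompactSupport f := by
  refine HasCompactSupport.intro (isCompact_closedBall (0 : E2) 2) fun x hx => hf x ?_
  have : 2 < ‖x‖ := by simpa using hx
  nlinarith

lemma test_G {a : ℝ} (ha : 1 ≤ a) : IsTestFun (fun x => G a (‖x‖ ^ 2)) :=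
  ⟨(G_contDiff a).comp (contDiff_norm_sq ℝ), compact_of_far _ fun _ hx => G_far ha hx⟩

lemma P_cont (a : ℝ) : Continuous (P a) := by
  unfold P
  exact continuous_const.mul (dh_cont.comp (by fun_prop))

lemma P_supp {a : ℝ} (ha : 1 ≤ a) : HasCompactSupport (P a) := by
  refine compact_of_far _ fun x hx => ?_
  unfold P
  rw [dh_zero (by nlinarith), mul_zero]

lemma P_nonneg {a : ℝ} (ha : 1 ≤ a) (x : E2) : 0 ≤ P a x :=
  mul_nonneg (by linarith) (dh_nonneg _)

lemma P_int {a : ℝ} (ha : 1 ≤ a) : ∫ x, P a x = 2 * π := by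
  have := MeasureTheory.integral_fun_norm_addHaar (volume : Measure E2)
    (fun r => 2 * a * deriv h (a * r ^ 2))
  unfold P
  rw [this]
  have e : ∫ y in Set.Ioi (0 : ℝ), y ^ (Module.finrank ℝ E2 - 1) • (2 * a * deriv h (a * y ^ 2))
      = 1 - h (a * 0 ^ 2) := by
    have hf : Module.finrank ℝ E2 = 2 := by simp
    rw [hf]
    refine MeasureTheory.integral_Ioi_of_hasDerivAt_of_nonneg' (g := fun y => h (a * y ^ 2))
      (fun y _ => ?_) (fun y hy => ?_) ?_
    · have := (h_hasDeriv (a * y ^ 2)).comp y (((hasDerivAt_id y).pow 2).const_mul a)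
      refine this.congr_deriv ?_
      simp; ring
    · have hy' : 0 < y := hy
      have := dh_nonneg (a * y ^ 2)
      simp only [smul_eq_mul]
      positivity
    · refine tendsto_const_nhds.congr' ?_
      filter_upwards [eventually_ge_atTop 2] with y hy
      rw [h_one]
      nlinarith
  rw [e, h_zero (by simp)]
  have hv : (volume : Measure E2).real (Metric.ball 0 1) = π := by
    simp [Measure.real, EuclideanSpace.volume_ball_fin_two, Real.pi_pos.le]
  rw [hv]
  simp

end BB

/-- **Nonexistence of singular Liouville bubbles of mass `β ≥ 8π`.** There is no
distributional solution `ŵ` of `-Δŵ = μ e^{ŵ} + β δ₀` in `ℝ²` with `μ > 0`, `β ≥ 8π` and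
`∫_{ℝ²} μ e^{ŵ} dx < ∞`.  (Any such `ŵ` would satisfy
`ŵ(x) ≥ (β/2π) log(1/|x|) - C` near the origin by the Green representation formula on the
unit ball, so `e^{ŵ}` would fail to be integrable near `0`.) -/
theorem statement10 (w : E2 → ℝ) (μ β : ℝ) (hμ : 0 < μ) (hβ : 8 * π ≤ β)
    (hwloc : MeasureTheory.LocallyIntegrable w MeasureTheory.volume)
    (hint : MeasureTheory.Integrable (fun x => μ * Real.exp (w x)) MeasureTheory.volume)
    (heq : ∀ φ : E2 → ℝ, IsTestFun φ →
      ∫ x, w x * (-lap2 φ x) = (∫ x, μ * Real.exp (w x) * φ x) + β * φ 0) :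
    False := by
  obtain ⟨M, hM⟩ := BB.dh_bdd
  have hexp : Integrable (fun x => Real.exp (w x)) volume := by
    have := hint.const_mul μ⁻¹
    refine this.congr (Eventually.of_forall fun x => ?_)
    simp only; field_simp
  have wP : ∀ a : ℝ, 1 ≤ a → Integrable (fun x => w x * BB.P a x) volume := fun a ha => by
    simpa using hwloc.integrable_smul_right_of_hasCompactSupport (BB.P_cont a) (BB.P_supp ha)
  have eP : ∀ a : ℝ, 1 ≤ a → Integrable (fun x => Real.exp (w x) * BB.P a x) volume :=
    fun a ha => by
    simpa using hexp.locallyIntegrable.integrable_smul_right_of_hasCompactSupport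
      (BB.P_cont a) (BB.P_supp ha)
  have iP : ∀ a : ℝ, 1 ≤ a → Integrable (fun x => BB.P a x) volume := fun a ha =>
    (BB.P_cont a).integrable_of_hasCompactSupport (BB.P_supp ha)
  set A : ℝ → ℝ := fun a => ∫ x, w x * BB.P a x with hA
  set I : ℝ := ∫ x, Real.exp (w x) with hI
  have step1 : ∀ a : ℝ, 1 ≤ a → A 1 + 4 * π * Real.log a ≤ A a := by
    intro a ha
    have := heq _ (BB.test_G ha)
    simp only [BB.lap_G, mul_sub] at this
    rw [integral_sub (wP a ha) (wP 1 le_rfl)] at this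
    have hn : 0 ≤ ∫ x, μ * Real.exp (w x) * BB.G a (‖x‖ ^ 2) :=
      integral_nonneg fun x => mul_nonneg (by positivity) (BB.G_nonneg ha (by positivity))
    have h0 : BB.G a (‖(0 : E2)‖ ^ 2) = Real.log a / 2 := by simp [BB.G_zero]
    rw [h0] at this
    have hl := Real.log_nonneg ha
    simp only [hA]
    nlinarith
  have step2 : ∀ a : ℝ, 1 ≤ a → 2 * π * Real.exp (A a / (2 * π)) ≤ 2 * a * M * I := by
    intro a ha
    set m := A a / (2 * π) with hm
    have hmA : A a = 2 * π * m := by rw [hm]; field_simp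
    calc 2 * π * Real.exp m = ∫ x, Real.exp m * ((1 - m) * BB.P a x + w x * BB.P a x) := by
          rw [integral_const_mul, integral_add ((iP a ha).const_mul _) (wP a ha),
            integral_const_mul, BB.P_int ha]
          change _ = Real.exp m * ((1 - m) * (2 * π) + A a)
          rw [hmA]; ring
      _ ≤ ∫ x, Real.exp (w x) * BB.P a x := by
          refine integral_mono ((((iP a ha).const_mul _).add (wP a ha)).const_mul _) (eP a ha)
            fun x => ?_
          have e1 := Real.add_one_le_exp (w x - m)
          have e2 : Real.exp (w x) = Real.exp m * Real.exp (w x - m) := by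
            rw [← Real.exp_add]; ring_nf
          have e3 := mul_le_mul_of_nonneg_right
            (mul_le_mul_of_nonneg_left e1 (Real.exp_pos m).le) (BB.P_nonneg ha x)
          simp only [e2]
          linarith
      _ ≤ ∫ x, 2 * a * M * Real.exp (w x) := by
          refine integral_mono (eP a ha) (hexp.const_mul _) fun x => ?_
          have : BB.P a x ≤ 2 * a * M := by
            unfold BB.P
            exact mul_le_mul_of_nonneg_left (hM _) (by linarith)
          have := mul_le_mul_of_nonneg_left this (Real.exp_pos (w x)).le
          simp only
          linarith
      _ = 2 * a * M * I := by rw [integral_const_mul]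
  set c := 2 * π * Real.exp (A 1 / (2 * π)) with hc
  have hcpos : 0 < c := by positivity
  have step3 : ∀ a : ℝ, 1 ≤ a → c * a ≤ 2 * M * I := by
    intro a ha
    have ha0 : 0 < a := by linarith
    have h1 := step1 a ha
    have h2 : A 1 / (2 * π) + (Real.log a + Real.log a) ≤ A a / (2 * π) := by
      rw [le_div_iff₀ (by positivity)]
      have : A 1 / (2 * π) * (2 * π) = A 1 := by field_simp
      nlinarith
    have h3 := Real.exp_le_exp.2 h2
    rw [Real.exp_add, Real.exp_add, Real.exp_log ha0] at h3
    have h4 := step2 a ha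
    have h5 : c * (a * a) ≤ 2 * a * M * I := by
      refine le_trans ?_ h4
      rw [hc, mul_assoc]
      exact mul_le_mul_of_nonneg_left h3 (by positivity)
    have : a * (c * a) ≤ a * (2 * M * I) := by linarith
    exact le_of_mul_le_mul_left this ha0
  have h1 := step3 (max 1 ((2 * M * I + 1) / c)) (le_max_left _ _)
  have h2 : c * ((2 * M * I + 1) / c) ≤ c * max 1 ((2 * M * I + 1) / c) :=
    mul_le_mul_of_nonneg_left (le_max_right _ _) hcpos.le
  have h3 : c * ((2 * M * I + 1) / c) = 2 * M * I + 1 := by field_simp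
  linarith
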